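/- Suppose m ≥ 2. Then for every λ ∈ (0,∞)^m, R(λ̂, λ) < R(λ̂X, λ); that is, the estimator λ̂ based on (X,Y) strictly dominates the Clevenson–Zidek estimator λ̂X based on X alone, at every parameter point, under the standardized squared error loss. -/

import Mathlib

open scoped BigOperators ENNReal

/-- The Poisson(μ) probability of the value `k`. -/
noncomputable def poissonPmf (mu : ℝ) (k : ℕ) : ℝ :=
  mu ^ k * Real.exp (-mu) / (Nat.factorial k)

/-- Joint pmf of (X, Y): X_1, …, X_m, Y independent, X_i ~ Po(λ_i), Y ~ Po(Σ λ_i). -/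
noncomputable def jointPmf (m : ℕ) (lam : Fin m → ℝ) (x : Fin m → ℕ) (y : ℕ) : ℝ :=
  poissonPmf (∑ i, lam i) y * ∏ i, poissonPmf (lam i) (x i)

/-- Risk of an estimator δ under the standardized squared error loss, valued in [0,∞]. -/
noncomputable def risk (m : ℕ) (δ : (Fin m → ℕ) → ℕ → Fin m → ℝ) (lam : Fin m → ℝ) : ℝ≥0∞ :=
  ∑' x : Fin m → ℕ, ∑' y : ℕ,
    ENNReal.ofReal ((∑ i, (δ x y i - lam i) ^ 2 / lam i) * jointPmf m lam x y)

/-- The maximum likelihood estimator λ^ML (real division by zero is 0, giving 0/0 = 0). -/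
noncomputable def estML (m : ℕ) (x : Fin m → ℕ) (y : ℕ) (i : Fin m) : ℝ :=
  ((∑ j, (x j : ℝ)) + (y : ℝ)) / 2 * ((x i : ℝ) / ∑ j, (x j : ℝ))

/-- The shrinkage estimator λ^O. -/
noncomputable def estO (m : ℕ) (x : Fin m → ℕ) (y : ℕ) (i : Fin m) : ℝ :=
  ((∑ j, (x j : ℝ)) + (y : ℝ) + (m : ℝ) - 1) / 2 *
    ((x i : ℝ) / ((∑ j, (x j : ℝ)) + (m : ℝ) - 1))

/-- The second shrinkage estimator λ̂. -/
noncomputable def estHat (m : ℕ) (x : Fin m → ℕ) (y : ℕ) (i : Fin m) : ℝ :=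
  ((∑ j, (x j : ℝ)) + (y : ℝ)) / 2 * ((x i : ℝ) / ((∑ j, (x j : ℝ)) + (m : ℝ) - 1))

/-- The Clevenson–Zidek estimator λ̂X based on X alone. -/
noncomputable def estCZ (m : ℕ) (x : Fin m → ℕ) (y : ℕ) (i : Fin m) : ℝ :=
  (∑ j, (x j : ℝ)) * (x i : ℝ) / ((∑ j, (x j : ℝ)) + (m : ℝ) - 1)

/-- At most polynomial growth with respect to the size function `t`. -/
def PolyGrowth {α : Type*} (t : α → ℕ) (f : α → ℝ) : Prop :=
  ∃ (C : ℝ) (k : ℕ), 0 ≤ C ∧ ∀ a, |f a| ≤ C * (1 + (t a : ℝ)) ^ k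

namespace PolyGrowth

variable {α : Type*} {t : α → ℕ} {f g : α → ℝ}

theorem of_abs_le (C : ℝ) (k : ℕ) (h : ∀ a, |f a| ≤ C * (1 + (t a : ℝ)) ^ k) :
    PolyGrowth t f := by
  refine ⟨|C|, k, abs_nonneg _, fun a => (h a).trans ?_⟩
  gcongr
  exact le_abs_self C

theorem const (c : ℝ) : PolyGrowth t (fun _ => c) :=
  of_abs_le |c| 0 (by simp)

theorem size : PolyGrowth t (fun a => (t a : ℝ)) :=
  of_abs_le 1 1 fun a => by
    rw [abs_of_nonneg (by positivity)]
    linarith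

theorem mono (hf : PolyGrowth t f) (h : ∀ a, |g a| ≤ |f a|) : PolyGrowth t g := by
  obtain ⟨C, k, -, hC⟩ := hf
  exact of_abs_le C k fun a => (h a).trans (hC a)

theorem add (hf : PolyGrowth t f) (hg : PolyGrowth t g) : PolyGrowth t (fun a => f a + g a) := by
  obtain ⟨C, k, hC0, hC⟩ := hf
  obtain ⟨D, l, hD0, hD⟩ := hg
  refine of_abs_le (C + D) (k + l) fun a => (abs_add_le _ _).trans ?_
  have h1 : (1 : ℝ) ≤ 1 + (t a : ℝ) := by simp
  rw [add_mul]
  refine add_le_add ((hC a).trans ?_) ((hD a).trans ?_)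
  · gcongr
    omega
  · gcongr
    omega

theorem mul (hf : PolyGrowth t f) (hg : PolyGrowth t g) : PolyGrowth t (fun a => f a * g a) := by
  obtain ⟨C, k, hC0, hC⟩ := hf
  obtain ⟨D, l, hD0, hD⟩ := hg
  refine of_abs_le (C * D) (k + l) fun a => ?_
  rw [abs_mul, pow_add, mul_mul_mul_comm]
  exact mul_le_mul (hC a) (hD a) (abs_nonneg _) (by positivity)

theorem sub (hf : PolyGrowth t f) (hg : PolyGrowth t g) : PolyGrowth t (fun a => f a - g a) := by
  simpa [sub_eq_add_neg] using hf.add ((const (-1)).mul hg)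

theorem finset_sum {ι : Type*} (s : Finset ι) {F : ι → α → ℝ} (h : ∀ i, PolyGrowth t (F i)) :
    PolyGrowth t (fun a => ∑ i ∈ s, F i a) := by
  classical
  induction s using Finset.induction_on with
  | empty => simpa using const 0
  | insert i s hi ih => simpa [Finset.sum_insert hi] using (h i).add ih

theorem comp {G : ℕ → ℝ} (hG : PolyGrowth id G) : PolyGrowth t (fun a => G (t a)) := by
  obtain ⟨C, k, -, hC⟩ := hG
  exact of_abs_le C k fun a => hC (t a)

theorem pred {G : ℕ → ℝ} (hG : PolyGrowth id G) : PolyGrowth id (fun n => G (n - 1)) := by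
  obtain ⟨C, k, hC0, hC⟩ := hG
  refine of_abs_le C k fun n => (hC (n - 1)).trans ?_
  have : ((n - 1 : ℕ) : ℝ) ≤ n := by exact_mod_cast Nat.sub_le n 1
  simp only [id]
  gcongr

end PolyGrowth

theorem hasSum_congr {α : Type*} {f g : α → ℝ} {a : ℝ} (h : ∀ k, f k = g k) :
    HasSum f a ↔ HasSum g a := by
  rw [funext h]

theorem hasSum_poissonPmf (mu : ℝ) : HasSum (poissonPmf mu) 1 := by
  have h := (NormedSpace.expSeries_div_hasSum_exp mu).mul_right (Real.exp (-mu))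
  rw [← Real.exp_eq_exp_ℝ, ← Real.exp_add, add_neg_cancel, Real.exp_zero] at h
  exact (hasSum_congr fun k => by unfold poissonPmf; ring).2 h

theorem poissonPmf_pos {mu : ℝ} (h : 0 < mu) (k : ℕ) : 0 < poissonPmf mu k := by
  unfold poissonPmf
  positivity

theorem poissonPmf_succ (mu : ℝ) (k : ℕ) :
    ((k : ℝ) + 1) * poissonPmf mu (k + 1) = mu * poissonPmf mu k := by
  unfold poissonPmf
  rw [Nat.factorial_succ]
  push_cast
  field_simp
  ring

theorem hasSum_mul_poissonPmf {mu a : ℝ} {F : ℕ → ℝ}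
    (h : HasSum (fun k => F (k + 1) * poissonPmf mu k) a) :
    HasSum (fun k : ℕ => (k : ℝ) * F k * poissonPmf mu k) (mu * a) := by
  refine (Nat.succ_injective.hasSum_iff ?_).1 ((hasSum_congr fun k => ?_).2 (h.mul_left mu))
  · intro k hk
    cases k with
    | zero => simp
    | succ k => exact absurd ⟨k, rfl⟩ hk
  · have := poissonPmf_succ mu k
    simp only [Function.comp, Nat.succ_eq_add_one]
    push_cast
    linear_combination (F (k + 1)) * this

theorem hasSum_id_poissonPmf (mu : ℝ) : HasSum (fun k : ℕ => (k : ℝ) * poissonPmf mu k) mu := by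
  simpa using hasSum_mul_poissonPmf (F := fun _ => 1)
    (a := 1) (by simpa using hasSum_poissonPmf mu)

theorem hasSum_sq_poissonPmf (mu : ℝ) :
    HasSum (fun k : ℕ => (k : ℝ) ^ 2 * poissonPmf mu k) (mu ^ 2 + mu) := by
  have h := hasSum_mul_poissonPmf (F := fun k => (k : ℝ)) (a := mu + 1)
    ((hasSum_congr fun k => by push_cast; ring).2
      ((hasSum_id_poissonPmf mu).add (hasSum_poissonPmf mu)))
  rw [show mu ^ 2 + mu = mu * (mu + 1) by ring]
  exact (hasSum_congr fun k => by ring).2 h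

theorem summable_prod_pi {m : ℕ} {f : Fin m → ℕ → ℝ} (h0 : ∀ i k, 0 ≤ f i k)
    (hf : ∀ i, Summable (f i)) : Summable (fun x : Fin m → ℕ => ∏ i, f i (x i)) := by
  induction m with
  | zero => exact Summable.of_finite
  | succ m ih =>
    rw [← (Fin.consEquiv fun _ => ℕ).summable_iff]
    have h := (hf 0).mul_of_nonneg (ih (fun i => h0 i.succ) fun i => hf i.succ) (h0 0)
      (fun x => Finset.prod_nonneg fun i _ => h0 i.succ (x i))
    refine h.congr fun p => ?_
    simp [Fin.prod_univ_succ, Fin.consEquiv]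

/-- The total count of the sample `x`. -/
def totalCount {m : ℕ} (x : Fin m → ℕ) : ℕ := ∑ i, x i

/-- The marginal pmf of `X`. -/
noncomputable def marginalPmf {m : ℕ} (lam : Fin m → ℝ) (x : Fin m → ℕ) : ℝ :=
  ∏ i, poissonPmf (lam i) (x i)

section marginal

variable {m : ℕ} {lam : Fin m → ℝ}

theorem totalCount_add_single (x : Fin m → ℕ) (i : Fin m) :
    totalCount (x + Pi.single i 1) = totalCount x + 1 := by
  simp [totalCount, Finset.sum_add_distrib]

theorem PolyGrowth.coord (i : Fin m) :
    PolyGrowth totalCount (fun x : Fin m → ℕ => (x i : ℝ)) :=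
  PolyGrowth.size.mono fun x => by
    rw [Nat.abs_cast, Nat.abs_cast]
    exact_mod_cast Finset.single_le_sum (f := x) (fun _ _ => Nat.zero_le _) (Finset.mem_univ i)

theorem marginalPmf_pos (hlam : ∀ i, 0 < lam i) (x : Fin m → ℕ) : 0 < marginalPmf lam x :=
  Finset.prod_pos fun i _ => poissonPmf_pos (hlam i) _

theorem summable_pow_mul_marginalPmf (hlam : ∀ i, 0 < lam i) {r : ℝ} (hr : 0 ≤ r) :
    Summable (fun x => r ^ totalCount x * marginalPmf lam x) := by
  have h := summable_prod_pi (f := fun i k => r ^ k * poissonPmf (lam i) k)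
    (fun i k => mul_nonneg (pow_nonneg hr k) (poissonPmf_pos (hlam i) k).le) (fun i => by
      refine ((Real.summable_pow_div_factorial (r * lam i)).mul_right
        (Real.exp (-lam i))).congr fun k => ?_
      unfold poissonPmf
      rw [mul_pow]
      ring)
  refine h.congr fun x => ?_
  rw [Finset.prod_mul_distrib, Finset.prod_pow_eq_pow_sum]
  rfl

theorem PolyGrowth.summable {f : (Fin m → ℕ) → ℝ} (hf : PolyGrowth totalCount f)
    (hlam : ∀ i, 0 < lam i) : Summable (fun x => f x * marginalPmf lam x) := by
  obtain ⟨C, k, hC0, hC⟩ := hf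
  refine Summable.of_norm_bounded
    ((summable_pow_mul_marginalPmf hlam (r := 2 ^ k) (by positivity)).mul_left C) fun x => ?_
  have hw := marginalPmf_pos hlam x
  rw [norm_mul, Real.norm_eq_abs, Real.norm_of_nonneg hw.le, ← mul_assoc]
  refine mul_le_mul_of_nonneg_right ((hC x).trans ?_) hw.le
  rw [← pow_mul, mul_comm k, pow_mul]
  have h : 1 + (totalCount x : ℝ) ≤ 2 ^ totalCount x := by
    exact_mod_cast (by have := Nat.lt_two_pow_self (n := totalCount x); omega :
      1 + totalCount x ≤ 2 ^ totalCount x)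
  gcongr

theorem marginalPmf_add_single (x : Fin m → ℕ) (i : Fin m) :
    ((x i : ℝ) + 1) * marginalPmf lam (x + Pi.single i 1) = lam i * marginalPmf lam x := by
  have hrest : ∏ j ∈ Finset.univ.erase i, poissonPmf (lam j) ((x + Pi.single i 1 : Fin m → ℕ) j) =
      ∏ j ∈ Finset.univ.erase i, poissonPmf (lam j) (x j) :=
    Finset.prod_congr rfl fun j hj => by simp [Pi.single_eq_of_ne (Finset.ne_of_mem_erase hj)]
  unfold marginalPmf
  rw [← Finset.mul_prod_erase _ _ (Finset.mem_univ i),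
    ← Finset.mul_prod_erase _ (fun j => poissonPmf (lam j) (x j)) (Finset.mem_univ i), hrest,
    ← mul_assoc, ← mul_assoc]
  simp only [Pi.add_apply, Pi.single_eq_same, poissonPmf_succ]

/-- The identity `E[X_i F(X)] = λ_i E[F(X + e_i)]`. -/
theorem hasSum_shift (hlam : ∀ i, 0 < lam i) {F : (Fin m → ℕ) → ℝ} (hF : PolyGrowth totalCount F)
    (i : Fin m) :
    HasSum (fun x => ((x i : ℝ) * F x - lam i * F (x + Pi.single i 1)) * marginalPmf lam x) 0 := by
  have h := (((PolyGrowth.coord i).mul hF).summable hlam).hasSum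
  have h' := (Function.Injective.hasSum_iff
    (g := fun x : Fin m → ℕ => x + Pi.single i 1) (add_left_injective _) ?_).2 h
  · rw [← sub_self (∑' x, (x i : ℝ) * F x * marginalPmf lam x)]
    refine (hasSum_congr fun x => ?_).2 (h.sub h')
    have := marginalPmf_add_single (lam := lam) x i
    simp only [Function.comp, Pi.add_apply, Pi.single_eq_same]
    push_cast
    linear_combination F (x + Pi.single i 1) * this
  · intro x hx
    rcases Nat.eq_zero_or_pos (x i) with h0 | h0
    · simp [h0]
    · refine absurd ⟨x - Pi.single i 1, ?_⟩ hx
      refine tsub_add_cancel_of_le fun j => ?_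
      by_cases hj : j = i
      · subst hj
        simpa using Nat.succ_le_of_lt h0
      · simp [hj]

/-- The identity `E[Z G(Z)] = Λ E[G(Z + 1)]` for the total count `Z`. -/
theorem hasSum_shift_total (hlam : ∀ i, 0 < lam i) {G : ℕ → ℝ} (hG : PolyGrowth id G) :
    HasSum (fun x => ((totalCount x : ℝ) * G (totalCount x)
      - (∑ i, lam i) * G (totalCount x + 1)) * marginalPmf lam x) 0 := by
  have h := hasSum_sum (s := Finset.univ) fun i _ => hasSum_shift hlam (hG.comp) i
  rw [Finset.sum_const_zero] at h
  refine (hasSum_congr fun x => ?_).2 h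
  simp only [totalCount_add_single]
  rw [← Finset.sum_mul, Finset.sum_sub_distrib, ← Finset.sum_mul, ← Finset.sum_mul]
  simp [totalCount]

/-- The identity `E[∑ X_i² / λ_i φ(Z)] = E[(Z + m) φ(Z + 1)]`. -/
theorem hasSum_shift_sq (hlam : ∀ i, 0 < lam i) {G : ℕ → ℝ} (hG : PolyGrowth id G) :
    HasSum (fun x => ((∑ i, (x i : ℝ) ^ 2 / lam i) * G (totalCount x)
      - ((totalCount x : ℝ) + m) * G (totalCount x + 1)) * marginalPmf lam x) 0 := by
  have h := hasSum_sum (s := Finset.univ) fun i _ =>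
    (hasSum_shift hlam ((PolyGrowth.coord i).mul hG.comp) i).mul_left (1 / lam i)
  simp only [mul_zero, Finset.sum_const_zero] at h
  refine (hasSum_congr fun x => ?_).2 h
  simp only [totalCount_add_single, Pi.add_apply, Pi.single_eq_same]
  have hterm : ∀ i, 1 / lam i * (((x i : ℝ) * ((x i : ℝ) * G (totalCount x))
      - lam i * (((x i + 1 : ℕ) : ℝ) * G (totalCount x + 1))) * marginalPmf lam x)
      = ((x i : ℝ) ^ 2 / lam i * G (totalCount x)
        - ((x i : ℝ) + 1) * G (totalCount x + 1)) * marginalPmf lam x := fun i => by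
    have := (hlam i).ne'
    push_cast
    field_simp
  simp only [hterm]
  rw [← Finset.sum_mul, Finset.sum_sub_distrib, ← Finset.sum_mul, ← Finset.sum_mul]
  simp [totalCount, Finset.sum_add_distrib]

end marginal

/-- The shrinkage factor `n / (n + m - 1)`. -/
noncomputable def shrinkFactor (m n : ℕ) : ℝ := (n : ℝ) / ((n : ℝ) + m - 1)

/-- A nonnegative function of the total count whose mean is `4 Λ` times the risk difference. -/
noncomputable def riskGap (m n : ℕ) : ℝ :=
  3 * (n : ℝ) ^ 2 * shrinkFactor m n
    - n * ((6 * ((n - 1 : ℕ) : ℝ) + 1) * shrinkFactor m (n - 1))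
    + 3 * (n * (((n - 1 : ℕ) : ℝ) * shrinkFactor m (n - 1 - 1)))

theorem riskGap_zero (m : ℕ) : riskGap m 0 = 0 := by simp [riskGap]

theorem riskGap_pos {m n : ℕ} (hm : 2 ≤ m) (hn : 1 ≤ n) : 0 < riskGap m n := by
  have hm' : (2 : ℝ) ≤ m := by exact_mod_cast hm
  obtain ⟨n, rfl⟩ := Nat.exists_eq_add_of_le' hn
  rcases n with _ | n
  · have : (0 : ℝ) < m := by linarith
    simp [riskGap, shrinkFactor]
    positivity
  · obtain ⟨v, hv⟩ : ∃ v : ℝ, v = m - 2 := ⟨_, rfl⟩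
    have hv0 : 0 ≤ v := by linarith
    have hmv : (m : ℝ) = v + 2 := by linarith
    have hn0 : (0 : ℝ) ≤ n := n.cast_nonneg
    simp only [riskGap, shrinkFactor, Nat.add_sub_cancel, hmv]
    push_cast
    have h1 : (n : ℝ) + 1 + 1 + (v + 2) - 1 = n + v + 3 := by ring
    have h2 : (n : ℝ) + 1 + (v + 2) - 1 = n + v + 2 := by ring
    have h3 : (n : ℝ) + (v + 2) - 1 = n + v + 1 := by ring
    rw [h1, h2, h3]
    have key : 3 * ((n : ℝ) + 1 + 1) ^ 2 * ((n + 1 + 1) / (n + v + 3))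
        - (n + 1 + 1) * ((6 * ((n : ℝ) + 1) + 1) * ((n + 1) / (n + v + 2)))
        + 3 * ((n + 1 + 1) * ((n + 1) * ((n : ℝ) / (n + v + 1))))
        = (n + 2) * ((n + 1) * (2 * (n + 2) ^ 2 - 5)
            + v * (2 * (2 * n + 5) * (n + 2) - 9 * (n + 2) + 6) + (2 * n + 5) * v ^ 2)
          / ((n + v + 1) * (n + v + 2) * (n + v + 3)) := by
      field_simp
      ring
    rw [key]
    have : 0 < ((n : ℝ) + 1) * (2 * (n + 2) ^ 2 - 5)
        + v * (2 * (2 * n + 5) * (n + 2) - 9 * (n + 2) + 6) + (2 * n + 5) * v ^ 2 := by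
      have e : ((n : ℝ) + 1) * (2 * (n + 2) ^ 2 - 5)
          + v * (2 * (2 * n + 5) * (n + 2) - 9 * (n + 2) + 6) + (2 * n + 5) * v ^ 2
          = (n + 1) * (2 * n ^ 2 + 8 * n + 3) + v * (4 * n ^ 2 + 9 * n + 8)
            + (2 * n + 5) * v ^ 2 := by ring
      rw [e]
      positivity
    positivity

theorem riskGap_nonneg {m : ℕ} (hm : 2 ≤ m) (n : ℕ) : 0 ≤ riskGap m n := by
  rcases Nat.eq_zero_or_pos n with rfl | hn
  · exact (riskGap_zero m).ge
  · exact (riskGap_pos hm hn).le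

theorem PolyGrowth.inv_shrink {m : ℕ} (hm : 2 ≤ m) :
    PolyGrowth id (fun n : ℕ => ((n : ℝ) + m - 1)⁻¹) := by
  refine (PolyGrowth.const 1).mono fun n => ?_
  have hm' : (2 : ℝ) ≤ m := by exact_mod_cast hm
  have hs : 1 ≤ (n : ℝ) + m - 1 := by linarith [n.cast_nonneg (α := ℝ)]
  rw [abs_one, abs_of_nonneg (inv_nonneg.2 (by linarith))]
  exact inv_le_one_of_one_le₀ hs

theorem PolyGrowth.shrinkFactor {m : ℕ} (hm : 2 ≤ m) : PolyGrowth id (shrinkFactor m) :=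
  PolyGrowth.size.mul (PolyGrowth.inv_shrink hm)

section risk

variable {m : ℕ} {lam : Fin m → ℝ}

/-- The loss, as a function of `c`, of the estimate with coordinates `c x_i / s`. -/
theorem loss_eq (hlam : ∀ i, 0 < lam i) (x : Fin m → ℕ) (c s : ℝ) :
    ∑ i, (c * ((x i : ℝ) / s) - lam i) ^ 2 / lam i
      = c ^ 2 * ((∑ i, (x i : ℝ) ^ 2 / lam i) * (s⁻¹) ^ 2)
        - 2 * c * (totalCount x * s⁻¹) + ∑ i, lam i := by
  have hterm : ∀ i, (c * ((x i : ℝ) / s) - lam i) ^ 2 / lam i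
      = c ^ 2 * (s⁻¹) ^ 2 * ((x i : ℝ) ^ 2 / lam i) - 2 * c * s⁻¹ * x i + lam i := fun i => by
    have := (hlam i).ne'
    rw [div_eq_mul_inv (x i : ℝ) s]
    generalize s⁻¹ = r
    field_simp
    ring
  simp only [hterm, Finset.sum_add_distrib, Finset.sum_sub_distrib, ← Finset.mul_sum]
  simp only [totalCount, Nat.cast_sum]
  ring

theorem risk_eq (hlam : ∀ i, 0 < lam i) {δ : (Fin m → ℕ) → ℕ → Fin m → ℝ}
    {A : (Fin m → ℕ) → ℝ} (hA : PolyGrowth totalCount A)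
    (h : ∀ x, HasSum (fun y => (∑ i, (δ x y i - lam i) ^ 2 / lam i)
      * poissonPmf (∑ i, lam i) y) (A x)) :
    risk m δ lam = ENNReal.ofReal (∑' x, A x * marginalPmf lam x) := by
  have hp : ∀ y, 0 ≤ poissonPmf (∑ i, lam i) y := fun y => by
    have : 0 ≤ ∑ i, lam i := Finset.sum_nonneg fun i _ => (hlam i).le
    unfold poissonPmf
    positivity
  have hloss : ∀ x y, 0 ≤ ∑ i, (δ x y i - lam i) ^ 2 / lam i := fun x y =>
    Finset.sum_nonneg fun i _ => div_nonneg (sq_nonneg _) (hlam i).le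
  have hw := fun x => (marginalPmf_pos hlam x).le
  have hA0 : ∀ x, 0 ≤ A x := fun x => (h x).nonneg fun y => mul_nonneg (hloss x y) (hp y)
  unfold risk
  rw [ENNReal.ofReal_tsum_of_nonneg (fun x => mul_nonneg (hA0 x) (hw x)) (hA.summable hlam)]
  refine tsum_congr fun x => ?_
  have hx := (h x).mul_right (marginalPmf lam x)
  rw [← hx.tsum_eq, ENNReal.ofReal_tsum_of_nonneg
    (fun y => mul_nonneg (mul_nonneg (hloss x y) (hp y)) (hw x)) hx.summable]
  exact tsum_congr fun y => by rw [jointPmf, mul_assoc]; rfl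

/-- The loss of `estCZ`. -/
noncomputable def lossCZ (lam : Fin m → ℝ) (x : Fin m → ℕ) : ℝ :=
  (totalCount x : ℝ) ^ 2
      * ((∑ i, (x i : ℝ) ^ 2 / lam i)
        * (((totalCount x : ℝ) + m - 1)⁻¹ * ((totalCount x : ℝ) + m - 1)⁻¹))
    - 2 * totalCount x * (totalCount x * ((totalCount x : ℝ) + m - 1)⁻¹) + ∑ i, lam i

/-- The conditional mean given `X` of the loss of `estHat`. -/
noncomputable def meanLossHat (lam : Fin m → ℝ) (x : Fin m → ℕ) : ℝ :=
  (((totalCount x : ℝ) + ∑ i, lam i) * ((totalCount x : ℝ) + ∑ i, lam i) + ∑ i, lam i) * (1 / 4)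
      * ((∑ i, (x i : ℝ) ^ 2 / lam i)
        * (((totalCount x : ℝ) + m - 1)⁻¹ * ((totalCount x : ℝ) + m - 1)⁻¹))
    - ((totalCount x : ℝ) + ∑ i, lam i) * (totalCount x * ((totalCount x : ℝ) + m - 1)⁻¹)
    + ∑ i, lam i

theorem PolyGrowth.sum_sq_div :
    PolyGrowth totalCount (fun x : Fin m → ℕ => ∑ i, (x i : ℝ) ^ 2 / lam i) := by
  refine PolyGrowth.finset_sum _ fun i => ?_
  simp only [div_eq_mul_inv, sq]
  exact ((PolyGrowth.coord i).mul (PolyGrowth.coord i)).mul (PolyGrowth.const _)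

theorem PolyGrowth.lossCZ (hm : 2 ≤ m) : PolyGrowth totalCount (lossCZ lam) := by
  have hi := (PolyGrowth.inv_shrink hm).comp (t := totalCount (m := m))
  have hz := PolyGrowth.size (t := totalCount (m := m))
  unfold _root_.lossCZ
  simp only [sq (totalCount _ : ℝ)]
  exact (((hz.mul hz).mul (PolyGrowth.sum_sq_div.mul (hi.mul hi))).sub
    (((PolyGrowth.const 2).mul hz).mul (hz.mul hi))).add (PolyGrowth.const _)

theorem PolyGrowth.meanLossHat (hm : 2 ≤ m) : PolyGrowth totalCount (meanLossHat lam) := by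
  have hi := (PolyGrowth.inv_shrink hm).comp (t := totalCount (m := m))
  have hz := PolyGrowth.size (t := totalCount (m := m))
  have hl := PolyGrowth.const (t := totalCount (m := m)) (∑ i, lam i)
  exact ((((((hz.add hl).mul (hz.add hl)).add hl).mul (PolyGrowth.const (1 / 4))).mul
    (PolyGrowth.sum_sq_div.mul (hi.mul hi))).sub ((hz.add hl).mul (hz.mul hi))).add hl

theorem risk_estCZ (hm : 2 ≤ m) (hlam : ∀ i, 0 < lam i) :
    risk m (estCZ m) lam = ENNReal.ofReal (∑' x, lossCZ lam x * marginalPmf lam x) := by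
  refine risk_eq hlam (PolyGrowth.lossCZ hm) fun x => ?_
  have h := (hasSum_poissonPmf (∑ i, lam i)).mul_left (lossCZ lam x)
  rw [mul_one] at h
  refine (hasSum_congr fun y => ?_).2 h
  have hl := loss_eq hlam x (totalCount x) ((totalCount x : ℝ) + m - 1)
  have hc : ∑ j, (x j : ℝ) = totalCount x := by simp [totalCount]
  simp only [estCZ, hc, mul_div_assoc, hl, lossCZ]
  ring

theorem risk_estHat (hm : 2 ≤ m) (hlam : ∀ i, 0 < lam i) :
    risk m (estHat m) lam = ENNReal.ofReal (∑' x, meanLossHat lam x * marginalPmf lam x) := by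
  refine risk_eq hlam (PolyGrowth.meanLossHat hm) fun x => ?_
  have hc : ∑ j, (x j : ℝ) = totalCount x := by simp [totalCount]
  simp only [estHat, hc, loss_eq hlam x, meanLossHat]
  generalize ∑ i, (x i : ℝ) ^ 2 / lam i = P
  generalize ((totalCount x : ℝ) + m - 1)⁻¹ = r
  generalize (totalCount x : ℝ) = z
  generalize ∑ i, lam i = L
  have h := (((hasSum_poissonPmf L).mul_left (z ^ 2 / 4 * (P * r ^ 2) - z * (z * r) + L)).add
    ((hasSum_id_poissonPmf L).mul_left (z / 2 * (P * r ^ 2) - z * r))).add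
    ((hasSum_sq_poissonPmf L).mul_left (1 / 4 * (P * r ^ 2)))
  rw [show ((z + L) * (z + L) + L) * (1 / 4) * (P * (r * r)) - (z + L) * (z * r) + L
    = (z ^ 2 / 4 * (P * r ^ 2) - z * (z * r) + L) * 1 + (z / 2 * (P * r ^ 2) - z * r) * L
      + 1 / 4 * (P * r ^ 2) * (L ^ 2 + L) by ring]
  exact (hasSum_congr fun y => by ring).2 h

theorem meanLossHat_nonneg (hlam : ∀ i, 0 < lam i) (x : Fin m → ℕ) : 0 ≤ meanLossHat lam x := by
  have hL : 0 ≤ ∑ i, lam i := Finset.sum_nonneg fun i _ => (hlam i).le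
  have hP : 0 ≤ ∑ i, (x i : ℝ) ^ 2 / lam i :=
    Finset.sum_nonneg fun i _ => div_nonneg (sq_nonneg _) (hlam i).le
  have h : 0 ≤ ∑ i, (((totalCount x : ℝ) + ∑ i, lam i) / 2
      * ((x i : ℝ) / ((totalCount x : ℝ) + m - 1)) - lam i) ^ 2 / lam i :=
    Finset.sum_nonneg fun i _ => div_nonneg (sq_nonneg _) (hlam i).le
  rw [loss_eq hlam] at h
  have h' : 0 ≤ (∑ i, lam i) / 4
      * ((∑ i, (x i : ℝ) ^ 2 / lam i) * (((totalCount x : ℝ) + m - 1)⁻¹) ^ 2) := by positivity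
  unfold meanLossHat
  linear_combination h + h'

theorem hasSum_loss_sub_riskGap (hm : 2 ≤ m) (hlam : ∀ i, 0 < lam i) (hL : 0 < ∑ i, lam i) :
    HasSum (fun x => (lossCZ lam x - meanLossHat lam x
      - (4 * ∑ i, lam i)⁻¹ * riskGap m (totalCount x)) * marginalPmf lam x) 0 := by
  have hi := PolyGrowth.inv_shrink hm
  have hz := PolyGrowth.size (t := (id : ℕ → ℕ))
  have hl := PolyGrowth.const (t := (id : ℕ → ℕ)) (∑ i, lam i)
  have hg := PolyGrowth.shrinkFactor hm
  have hφ := ((hz.mul hz).sub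
    ((((hz.add hl).mul (hz.add hl)).add hl).mul (PolyGrowth.const (1 / 4)))).mul (hi.mul hi)
  have h0 := hasSum_shift_sq hlam hφ
  have h1 := hasSum_shift_total hlam (((hz.add (PolyGrowth.const (m : ℝ))).sub
    (PolyGrowth.const 1)).mul hφ)
  have h2 := hasSum_shift_total hlam
    ((((PolyGrowth.const 6).mul hz).add (PolyGrowth.const 1)).mul hg).pred
  have h3 := hasSum_shift_total hlam (hl.mul hg.pred)
  have h4 := hasSum_shift_total hlam (hz.mul hg.pred).pred
  have h := (h0.sub (h1.mul_left (∑ i, lam i)⁻¹)).add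
    (((h2.sub (h3.mul_left 3)).sub (h4.mul_left 3)).mul_left (4 * ∑ i, lam i)⁻¹)
  simp only [mul_zero, sub_zero, add_zero] at h
  refine (hasSum_congr fun x => ?_).2 h
  have hm' : (2 : ℝ) ≤ m := by exact_mod_cast hm
  simp only [lossCZ, meanLossHat, riskGap, Nat.add_sub_cancel, id]
  generalize shrinkFactor m (totalCount x - 1 - 1) = g2
  generalize shrinkFactor m (totalCount x - 1) = g1
  generalize ((totalCount x - 1 : ℕ) : ℝ) = z1
  simp only [shrinkFactor]
  generalize ∑ i, (x i : ℝ) ^ 2 / lam i = P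
  generalize marginalPmf lam x = w
  generalize hLL : ∑ i, lam i = L at *
  push_cast
  have hz0 : (0 : ℝ) ≤ totalCount x := Nat.cast_nonneg _
  generalize (totalCount x : ℝ) = z at *
  have hs : z + 1 + m - 1 = z + m := by ring
  obtain ⟨s, hs'⟩ : ∃ s, s = z + m - 1 := ⟨_, rfl⟩
  have hs0 : s ≠ 0 := by intro h; linarith
  have hs1 : z + m ≠ 0 := by intro h; linarith
  rw [hs, ← hs']
  field_simp
  ring

theorem tsum_meanLossHat_lt_tsum_lossCZ (hm : 2 ≤ m) (hlam : ∀ i, 0 < lam i) :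
    ∑' x, meanLossHat lam x * marginalPmf lam x < ∑' x, lossCZ lam x * marginalPmf lam x := by
  have i0 : Fin m := ⟨0, by omega⟩
  have hL : 0 < ∑ i, lam i := Finset.sum_pos (fun i _ => hlam i) ⟨i0, Finset.mem_univ _⟩
  have hCZ := (PolyGrowth.lossCZ (lam := lam) hm).summable hlam
  have hHat := (PolyGrowth.meanLossHat (lam := lam) hm).summable hlam
  have h := (hCZ.hasSum.sub hHat.hasSum).sub (hasSum_loss_sub_riskGap hm hlam hL)
  rw [sub_zero] at h
  have hgap : HasSum (fun x => (4 * ∑ i, lam i)⁻¹ * riskGap m (totalCount x) * marginalPmf lam x)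
      (∑' x, lossCZ lam x * marginalPmf lam x - ∑' x, meanLossHat lam x * marginalPmf lam x) :=
    (hasSum_congr fun x => by ring).2 h
  rw [← sub_pos, ← hgap.tsum_eq]
  have hc : 0 < (4 * ∑ i, lam i)⁻¹ := by positivity
  refine hgap.summable.tsum_pos (fun x => mul_nonneg (mul_nonneg hc.le (riskGap_nonneg hm _))
    (marginalPmf_pos hlam x).le) (Pi.single i0 1) (mul_pos (mul_pos hc (riskGap_pos hm ?_))
    (marginalPmf_pos hlam _))
  simp [totalCount]

end risk

/- STATEMENT 4: for m ≥ 2, λ̂ (based on (X,Y)) strictly dominates the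
Clevenson–Zidek estimator λ̂X (based on X alone) at every parameter point. -/
theorem stmt_4 (m : ℕ) (hm : 2 ≤ m) (lam : Fin m → ℝ) (hlam : ∀ i, 0 < lam i) :
    risk m (estHat m) lam < risk m (estCZ m) lam := by
  rw [risk_estHat hm hlam, risk_estCZ hm hlam]
  have h := tsum_meanLossHat_lt_tsum_lossCZ hm hlam
  have h0 : 0 ≤ ∑' x, meanLossHat lam x * marginalPmf lam x :=
    tsum_nonneg fun x => mul_nonneg (meanLossHat_nonneg hlam x) (marginalPmf_pos hlam x).le
  exact (ENNReal.ofReal_lt_ofReal_iff (h0.trans_lt h)).2 h
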